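/- Suppose V̂ satisfies the Bellman equation for π. Then for any two distinct actions a ≠ a', the covariance between the δHCA advantage estimates is at least that between the Monte-Carlo advantage estimates: cov_π(Â^δHCA_N(a), Â^δHCA_N(a') | S_0 = s) ≥ cov_π(Â^MC_N(a), Â^MC_N(a') | S_0 = s). -/

import Mathlib

open Finset

attribute [local instance] Classical.propDecidable

namespace HCA

/-- A trajectory of horizon `N`: the actions taken at steps `0, …, N-1` and the
states reached after each step (the start state is fixed separately). -/
abbrev Traj (S A : Type*) (N : ℕ) : Type _ := (Fin N → A) × (Fin N → S)

variable {S A : Type*} [Fintype S] [Fintype A] [Nonempty S] [Nonempty A]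

/-- The state `S_k` of a trajectory with start state `s`. -/
def st {N : ℕ} (s : S) (τ : Traj S A N) : ℕ → S
  | 0 => s
  | k + 1 => if h : k < N then τ.2 ⟨k, h⟩ else s

/-- The action `A_k` of a trajectory. -/
noncomputable def ac {N : ℕ} (τ : Traj S A N) (k : ℕ) : A :=
  if h : k < N then τ.1 ⟨k, h⟩ else Classical.arbitrary A

/-- The probability `P_π(τ) = ∏_{k=0}^{N-1} π(A_k|S_k)·P(S_{k+1}|S_k,A_k)` of a
trajectory starting at `s`. -/
noncomputable def trajP (π : S → A → ℝ) (P : S → A → S → ℝ) (s : S) (N : ℕ)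
    (τ : Traj S A N) : ℝ :=
  ∏ k : Fin N, π (st s τ k) (τ.1 k) * P (st s τ k) (τ.1 k) (st s τ (k + 1))

/-- Expectation `E_π[f | S_0 = s]` over trajectories. -/
noncomputable def expct (π : S → A → ℝ) (P : S → A → S → ℝ) (s : S) (N : ℕ)
    (f : Traj S A N → ℝ) : ℝ :=
  ∑ τ : Traj S A N, trajP π P s N τ * f τ

/-- Variance `Var_π(f | S_0 = s)` over trajectories. -/
noncomputable def vr (π : S → A → ℝ) (P : S → A → S → ℝ) (s : S) (N : ℕ)
    (f : Traj S A N → ℝ) : ℝ :=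
  expct π P s N (fun τ => (f τ - expct π P s N f) ^ 2)

/-- Covariance `cov_π(f, g | S_0 = s)` over trajectories. -/
noncomputable def cv (π : S → A → ℝ) (P : S → A → S → ℝ) (s : S) (N : ℕ)
    (f g : Traj S A N → ℝ) : ℝ :=
  expct π P s N (fun τ => (f τ - expct π P s N f) * (g τ - expct π P s N g))

/-- Probability `P_π(E | S_0 = s)` of an event `E` on trajectories. -/
noncomputable def prE (π : S → A → ℝ) (P : S → A → S → ℝ) (s : S) (N : ℕ)
    (E : Traj S A N → Prop) : ℝ :=
  ∑ τ : Traj S A N, if E τ then trajP π P s N τ else 0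

/-- The TD error `δ_k = r(S_k,A_k) + γ·V̂(S_{k+1}) − V̂(S_k)`. -/
noncomputable def td (r : S → A → ℝ) (γ : ℝ) (V : S → ℝ) (s : S) {N : ℕ}
    (τ : Traj S A N) (k : ℕ) : ℝ :=
  r (st s τ k) (ac τ k) + γ * V (st s τ (k + 1)) - V (st s τ k)

/-- `p_k(s'|s,a) = P_π(S_k = s' | S_0 = s, A_0 = a)
  = P_π(A_0 = a, S_k = s' | S_0 = s) / π(a|s)`. -/
noncomputable def pkSA (π : S → A → ℝ) (P : S → A → S → ℝ) (s : S) (N k : ℕ)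
    (a : A) (s' : S) : ℝ :=
  prE π P s N (fun τ => ac τ 0 = a ∧ st s τ k = s') / π s a

/-- `p_k(s'|s) = Σ_a π(a|s)·p_k(s'|s,a)`. -/
noncomputable def pkS (π : S → A → ℝ) (P : S → A → S → ℝ) (s : S) (N k : ℕ)
    (s' : S) : ℝ :=
  ∑ a : A, π s a * pkSA π P s N k a s'

/-- The hindsight probability `p_k(a|s,s')`, defined as
`P_π(A_0 = a, S_k = s' | S_0 = s)/p_k(s'|s)` when `p_k(s'|s) > 0` and `0` otherwise. -/
noncomputable def pkA (π : S → A → ℝ) (P : S → A → S → ℝ) (s : S) (N k : ℕ)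
    (a : A) (s' : S) : ℝ :=
  if 0 < pkS π P s N k s' then
    prE π P s N (fun τ => ac τ 0 = a ∧ st s τ k = s') / pkS π P s N k s'
  else 0

/-- The `N`-step Monte-Carlo advantage estimator
`Â^MC_N(a) = (1(A_0=a)/π(a|s))·Σ_{k=0}^{N−1} γ^k·δ_k`. -/
noncomputable def mcEst (π : S → A → ℝ) (r : S → A → ℝ) (γ : ℝ) (V : S → ℝ)
    (s : S) (N : ℕ) (a : A) (τ : Traj S A N) : ℝ :=
  ((if ac τ 0 = a then (1 : ℝ) else 0) / π s a) * ∑ k ∈ range N, γ ^ k * td r γ V s τ k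

/-- The `N`-step δHCA advantage estimator
`Â^δHCA_N(a) = (1(A_0=a)/π(a|s))·δ_0 + Σ_{k=1}^{N−1} γ^k·(p_k(a|s,S_k)/π(a|s))·δ_k`. -/
noncomputable def dhcaEst (π : S → A → ℝ) (P : S → A → S → ℝ) (r : S → A → ℝ)
    (γ : ℝ) (V : S → ℝ) (s : S) (N : ℕ) (a : A) (τ : Traj S A N) : ℝ :=
  ((if ac τ 0 = a then (1 : ℝ) else 0) / π s a) * td r γ V s τ 0
    + ∑ k ∈ Ico 1 N, γ ^ k * (pkA π P s N k a (st s τ k) / π s a) * td r γ V s τ k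

/-- `V` satisfies the Bellman equation for `π`:
`V(s₀) = Σ_a π(a|s₀)·(r(s₀,a) + γ·Σ_{s'} P(s'|s₀,a)·V(s'))` for every state `s₀`. -/
def IsBellman (π : S → A → ℝ) (P : S → A → S → ℝ) (r : S → A → ℝ) (γ : ℝ)
    (V : S → ℝ) : Prop :=
  ∀ s₀ : S, V s₀ = ∑ a : A, π s₀ a * (r s₀ a + γ * ∑ s' : S, P s₀ a s' * V s')

/-- The conditional second moment `E_π[δ_k² | S_0 = s, S_k = s']`,
defined as `(Σ_{τ : S_k = s'} P_π(τ)·δ_k(τ)²)/p_k(s'|s)`. -/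
noncomputable def sndMom (π : S → A → ℝ) (P : S → A → S → ℝ) (r : S → A → ℝ)
    (γ : ℝ) (V : S → ℝ) (s : S) (N k : ℕ) (s' : S) : ℝ :=
  (∑ τ : Traj S A N, if st s τ k = s' then trajP π P s N τ * (td r γ V s τ k) ^ 2 else 0)
    / pkS π P s N k s'

/-- Extend a trajectory by one step. -/
def sn {S A : Type*} {N : ℕ} (τ : Traj S A N) (a : A) (s' : S) : Traj S A (N + 1) :=
  (Fin.snoc (α := fun _ => A) τ.1 a, Fin.snoc (α := fun _ => S) τ.2 s')

lemma st_sn {S A : Type*} {N : ℕ} (s : S) (τ : Traj S A N) (a : A) (s' : S) (k : ℕ)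
    (hk : k ≤ N) : st s (sn τ a s') k = st s τ k := by
  cases k with
  | zero => rfl
  | succ k =>
    have h1 : k < N := hk
    have h2 : k < N + 1 := by omega
    simp [st, sn, Fin.snoc, h1, h2]

lemma st_sn_last {S A : Type*} {N : ℕ} (s : S) (τ : Traj S A N) (a : A) (s' : S) :
    st s (sn τ a s') (N + 1) = s' := by
  simp [st, sn, Fin.snoc]

lemma ac_sn {S A : Type*} [Nonempty A] {N : ℕ} (τ : Traj S A N) (a : A) (s' : S) (k : ℕ)
    (hk : k < N) : ac (sn τ a s') k = ac τ k := by
  have h2 : k < N + 1 := by omega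
  simp [ac, sn, Fin.snoc, hk, h2]

lemma ac_sn_last {S A : Type*} [Nonempty A] {N : ℕ} (τ : Traj S A N) (a : A) (s' : S) :
    ac (sn τ a s') N = a := by
  simp [ac, sn, Fin.snoc]

lemma trajP_sn {S A : Type*} (π : S → A → ℝ) (P : S → A → S → ℝ) (s : S) {N : ℕ}
    (τ : Traj S A N) (a : A) (s' : S) :
    trajP π P s (N + 1) (sn τ a s')
      = trajP π P s N τ * (π (st s τ N) a * P (st s τ N) a s') := by
  unfold trajP
  rw [Fin.prod_univ_castSucc]
  congr 1
  · refine Finset.prod_congr rfl fun k _ => ?_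
    have e1 : (sn τ a s').1 k.castSucc = τ.1 k := by simp [sn]
    rw [e1, Fin.val_castSucc, st_sn s τ a s' k k.2.le, st_sn s τ a s' (k + 1) k.2]
  · have e1 : (sn τ a s').1 (Fin.last N) = a := by simp [sn]
    rw [e1, Fin.val_last, st_sn s τ a s' N le_rfl, st_sn_last]

lemma expct_succ {S A : Type*} [Fintype S] [Fintype A]
    (π : S → A → ℝ) (P : S → A → S → ℝ) (s : S) (N : ℕ) (G : Traj S A (N + 1) → ℝ) :
    expct π P s (N + 1) G = expct π P s N (fun τ => ∑ a, ∑ s',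
      π (st s τ N) a * P (st s τ N) a s' * G (sn τ a s')) := by
  unfold expct
  have e : ∑ τ : Traj S A (N + 1), trajP π P s (N + 1) τ * G τ
      = ∑ a : A, ∑ x : Fin N → A, ∑ s' : S, ∑ y : Fin N → S,
        trajP π P s (N + 1) (sn (x, y) a s') * G (sn (x, y) a s') := by
    rw [Fintype.sum_prod_type, ← (Fin.snocEquiv (fun _ : Fin (N + 1) => A)).sum_comp,
      Fintype.sum_prod_type]
    refine Finset.sum_congr rfl fun a _ => Finset.sum_congr rfl fun x _ => ?_
    rw [← (Fin.snocEquiv (fun _ : Fin (N + 1) => S)).sum_comp, Fintype.sum_prod_type]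
    rfl
  rw [e, Finset.sum_comm, Fintype.sum_prod_type]
  refine Finset.sum_congr rfl fun x _ => ?_
  simp only [Finset.mul_sum]
  rw [Finset.sum_comm (s := (Finset.univ : Finset (Fin N → S)))]
  refine Finset.sum_congr rfl fun a _ => ?_
  rw [Finset.sum_comm]
  refine Finset.sum_congr rfl fun y _ => Finset.sum_congr rfl fun s' _ => ?_
  rw [trajP_sn]
  ring

/-- `F` depends only on `A_0, …, A_{k-1}` and `S_0, …, S_k`. -/
def Adapted {S A : Type*} {N : ℕ} (k : ℕ) (F : Traj S A N → ℝ) : Prop :=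
  ∀ τ τ' : Traj S A N, (∀ i : Fin N, (i : ℕ) < k → τ.1 i = τ'.1 i ∧ τ.2 i = τ'.2 i) →
    F τ = F τ'

lemma st_congr {S A : Type*} {N : ℕ} (s : S) {k j : ℕ} {τ τ' : Traj S A N}
    (h : ∀ i : Fin N, (i : ℕ) < k → τ.1 i = τ'.1 i ∧ τ.2 i = τ'.2 i) (hj : j ≤ k) :
    st s τ j = st s τ' j := by
  cases j with
  | zero => rfl
  | succ j =>
    simp only [st]
    split_ifs with h1
    · exact (h ⟨j, h1⟩ hj).2
    · rfl

lemma ac_congr {S A : Type*} [Nonempty A] {N : ℕ} {k j : ℕ} {τ τ' : Traj S A N}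
    (h : ∀ i : Fin N, (i : ℕ) < k → τ.1 i = τ'.1 i ∧ τ.2 i = τ'.2 i) (hj : j < k) :
    ac τ j = ac τ' j := by
  simp only [ac]
  split_ifs with h1
  · exact (h ⟨j, h1⟩ hj).1
  · rfl

lemma td_congr {S A : Type*} [Nonempty A] {N : ℕ} (r : S → A → ℝ) (γ : ℝ) (V : S → ℝ) (s : S)
    {k j : ℕ} {τ τ' : Traj S A N}
    (h : ∀ i : Fin N, (i : ℕ) < k → τ.1 i = τ'.1 i ∧ τ.2 i = τ'.2 i) (hj : j < k) :
    td r γ V s τ j = td r γ V s τ' j := by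
  simp only [td]
  rw [st_congr s h hj.le, ac_congr h hj, st_congr s h (j := j + 1) hj]

lemma martingale {S A : Type*} [Fintype S] [Fintype A] [Nonempty S] [Nonempty A]
    (π : S → A → ℝ) (P : S → A → S → ℝ) (r : S → A → ℝ) (γ : ℝ) (s : S)
    (hπsum : ∀ s₀ : S, ∑ a : A, π s₀ a = 1)
    (hPsum : ∀ (s₀ : S) (a : A), ∑ s' : S, P s₀ a s' = 1)
    (V : S → ℝ) (hV : IsBellman π P r γ V) (k : ℕ) (N : ℕ) (hk : k < N)
    (F : Traj S A N → ℝ) (hF : Adapted k F) :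
    expct π P s N (fun τ => F τ * td r γ V s τ k) = 0 := by
  induction N with
  | zero => omega
  | succ N ih =>
    rw [expct_succ]
    obtain ⟨a₀⟩ := ‹Nonempty A›
    obtain ⟨s₀⟩ := ‹Nonempty S›
    have hF1 : ∀ τ a s', F (sn τ a s') = F (sn τ a₀ s₀) := by
      intro τ a s'
      refine hF _ _ fun i hi => ?_
      have hi' : (i : ℕ) < N := by omega
      simp [sn, Fin.snoc, hi']
    rcases Nat.lt_succ_iff_lt_or_eq.mp hk with hlt | heq
    · have hF' : Adapted k (fun τ => F (sn τ a₀ s₀)) := by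
        intro τ τ' h
        refine hF _ _ fun i hi => ?_
        have hi' : (i : ℕ) < N := by omega
        have := h ⟨i, hi'⟩ hi
        simp [sn, Fin.snoc, hi', Fin.castLT, this]
      rw [← ih hlt _ hF']
      congr 1
      funext τ
      have : ∀ a s', td r γ V s (sn τ a s') k = td r γ V s τ k := by
        intro a s'
        simp only [td]
        rw [st_sn _ _ _ _ _ hlt.le, ac_sn _ _ _ _ hlt, st_sn _ _ _ _ (k + 1) hlt]
      simp only [this, hF1, ← Finset.sum_mul, ← Finset.mul_sum, hPsum, mul_one, hπsum, one_mul]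
    · subst heq
      have : ∀ τ : Traj S A k, ∑ a, ∑ s', π (st s τ k) a * P (st s τ k) a s' *
          (F (sn τ a s') * td r γ V s (sn τ a s') k) = 0 := by
        intro τ
        have h1 : ∀ a, ∑ s', π (st s τ k) a * P (st s τ k) a s' *
          (F (sn τ a s') * td r γ V s (sn τ a s') k) = F (sn τ a₀ s₀) *
            (π (st s τ k) a * (r (st s τ k) a + γ * ∑ s', P (st s τ k) a s' * V s')
              - π (st s τ k) a * V (st s τ k)) := by
          intro a
          have h2 : ∀ s', π (st s τ k) a * P (st s τ k) a s' *
            (F (sn τ a s') * td r γ V s (sn τ a s') k) =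
              F (sn τ a₀ s₀) * π (st s τ k) a * (r (st s τ k) a - V (st s τ k))
                * P (st s τ k) a s'
              + F (sn τ a₀ s₀) * π (st s τ k) a * γ * (P (st s τ k) a s' * V s') := by
            intro s'
            simp only [td]
            rw [hF1, st_sn _ _ _ _ _ le_rfl, ac_sn_last, st_sn_last]
            ring
          simp only [h2, Finset.sum_add_distrib, ← Finset.mul_sum, hPsum]
          ring
        simp only [h1, ← Finset.mul_sum, Finset.sum_sub_distrib, ← Finset.sum_mul, hπsum]
        rw [← hV (st s τ k)]
        ring
      simp [expct, this]

lemma trajP_nonneg {S A : Type*} (π : S → A → ℝ) (P : S → A → S → ℝ) (s : S) (N : ℕ)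
    (hπpos : ∀ s₀ a, 0 < π s₀ a) (hPnn : ∀ s₀ a s', 0 ≤ P s₀ a s') (τ : Traj S A N) :
    0 ≤ trajP π P s N τ :=
  Finset.prod_nonneg fun _ _ => mul_nonneg (hπpos _ _).le (hPnn _ _ _)

lemma pkA_nonneg {S A : Type*} [Fintype S] [Fintype A] [Nonempty A]
    (π : S → A → ℝ) (P : S → A → S → ℝ) (s : S) (N k : ℕ)
    (hπpos : ∀ s₀ a, 0 < π s₀ a) (hPnn : ∀ s₀ a s', 0 ≤ P s₀ a s') (a : A) (s' : S) :
    0 ≤ pkA π P s N k a s' := by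
  unfold pkA
  split_ifs with h
  · refine div_nonneg (Finset.sum_nonneg fun τ _ => ?_) h.le
    split_ifs
    · exact trajP_nonneg π P s N hπpos hPnn τ
    · exact le_rfl
  · exact le_rfl

lemma cv_expand {S A : Type*} [Fintype S] [Fintype A]
    (π : S → A → ℝ) (P : S → A → S → ℝ) (s : S) (N : ℕ) (f g : Traj S A N → ℝ) :
    cv π P s N f g = expct π P s N (fun τ => f τ * g τ)
      - 2 * (expct π P s N f * expct π P s N g)
      + expct π P s N f * expct π P s N g * ∑ τ : Traj S A N, trajP π P s N τ := by
  have h : ∀ m n : ℝ, expct π P s N (fun τ => (f τ - m) * (g τ - n))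
      = expct π P s N (fun τ => f τ * g τ) - n * expct π P s N f - m * expct π P s N g
        + m * n * ∑ τ : Traj S A N, trajP π P s N τ := by
    intro m n
    simp only [expct, Finset.mul_sum]
    rw [← Finset.sum_sub_distrib, ← Finset.sum_sub_distrib, ← Finset.sum_add_distrib]
    refine Finset.sum_congr rfl fun τ _ => ?_
    ring
  unfold cv
  rw [h]
  ring

lemma expct_sum {S A : Type*} [Fintype S] [Fintype A]
    (π : S → A → ℝ) (P : S → A → S → ℝ) (s : S) (N : ℕ) (I : Finset ℕ)
    (f : ℕ → Traj S A N → ℝ) :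
    expct π P s N (fun τ => ∑ i ∈ I, f i τ) = ∑ i ∈ I, expct π P s N (f i) := by
  simp only [expct, Finset.mul_sum]
  rw [Finset.sum_comm]

/-- Coefficients of the Monte-Carlo estimator. -/
noncomputable def cM {S A : Type*} [Nonempty A] (π : S → A → ℝ) (γ : ℝ) (s : S) (N : ℕ) (a : A)
    (k : ℕ) (τ : Traj S A N) : ℝ :=
  ((if ac τ 0 = a then (1 : ℝ) else 0) / π s a) * γ ^ k

/-- Coefficients of the hindsight estimator. -/
noncomputable def cD {S A : Type*} [Fintype S] [Fintype A] [Nonempty A]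
    (π : S → A → ℝ) (P : S → A → S → ℝ) (γ : ℝ) (s : S) (N : ℕ) (a : A)
    (k : ℕ) (τ : Traj S A N) : ℝ :=
  if k = 0 then cM π γ s N a 0 τ else γ ^ k * (pkA π P s N k a (st s τ k) / π s a)

lemma mc_eq {S A : Type*} [Nonempty A] (π : S → A → ℝ) (r : S → A → ℝ) (γ : ℝ) (V : S → ℝ)
    (s : S) (N : ℕ) (a : A) : mcEst π r γ V s N a =
      fun τ => ∑ k ∈ range N, cM π γ s N a k τ * td r γ V s τ k := by
  funext τ
  simp only [mcEst, cM, Finset.mul_sum, mul_assoc]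

lemma dh_eq {S A : Type*} [Fintype S] [Fintype A] [Nonempty A]
    (π : S → A → ℝ) (P : S → A → S → ℝ) (r : S → A → ℝ) (γ : ℝ) (V : S → ℝ)
    (s : S) (N : ℕ) (hN : 1 ≤ N) (a : A) : dhcaEst π P r γ V s N a =
      fun τ => ∑ k ∈ range N, cD π P γ s N a k τ * td r γ V s τ k := by
  funext τ
  rw [Finset.range_eq_Ico, Finset.sum_eq_sum_Ico_succ_bot (by omega : 0 < N)]
  simp only [dhcaEst]
  congr 1
  · simp [cD, cM]
  · refine Finset.sum_congr rfl fun k hk => ?_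
    have : k ≠ 0 := by
      have := (Finset.mem_Ico.mp hk).1
      omega
    simp [cD, this]

lemma cM_congr {S A : Type*} [Nonempty A] (π : S → A → ℝ) (γ : ℝ) (s : S) (N : ℕ) (a : A)
    (j k : ℕ) (hk : 1 ≤ k) : Adapted k (cM π γ s N a j) := by
  intro τ τ' h
  simp only [cM]
  rw [ac_congr h hk]

lemma cD_congr {S A : Type*} [Fintype S] [Fintype A] [Nonempty A]
    (π : S → A → ℝ) (P : S → A → S → ℝ) (γ : ℝ) (s : S) (N : ℕ) (a : A)
    (j k : ℕ) (hk : 1 ≤ k) (hj : j ≤ k) : Adapted k (cD π P γ s N a j) := by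
  intro τ τ' h
  simp only [cD]
  rw [cM_congr π γ s N a 0 k hk τ τ' h, st_congr s h hj]

theorem stmt_13 {S A : Type*} [Fintype S] [Fintype A] [Nonempty S] [Nonempty A]
    (π : S → A → ℝ) (P : S → A → S → ℝ) (r : S → A → ℝ) (γ : ℝ)
    (N : ℕ) (s : S)
    (hπpos : ∀ s₀ a, 0 < π s₀ a) (hπsum : ∀ s₀ : S, ∑ a : A, π s₀ a = 1)
    (hPnn : ∀ s₀ a s', 0 ≤ P s₀ a s') (hPsum : ∀ (s₀ : S) (a : A), ∑ s' : S, P s₀ a s' = 1)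
    (hγ0 : 0 ≤ γ) (hγ1 : γ ≤ 1) (hN : 1 ≤ N)
    (V : S → ℝ) (hV : IsBellman π P r γ V)
    (a a' : A) (hne : a ≠ a') :
    cv π P s N (mcEst π r γ V s N a) (mcEst π r γ V s N a')
      ≤ cv π P s N (dhcaEst π P r γ V s N a) (dhcaEst π P r γ V s N a') := by
  have mart := martingale π P r γ s hπsum hPsum V hV
  have mean : ∀ b : A, expct π P s N (dhcaEst π P r γ V s N b)
      = expct π P s N (mcEst π r γ V s N b) := by
    intro b
    rw [mc_eq, dh_eq π P r γ V s N hN, expct_sum, expct_sum]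
    refine Finset.sum_congr rfl fun k hk => ?_
    have hk' := Finset.mem_range.mp hk
    rcases Nat.eq_zero_or_pos k with h0 | h0
    · subst h0
      simp [cD]
    · rw [mart k N hk' _ (cD_congr π P γ s N b k k h0 le_rfl),
        mart k N hk' _ (cM_congr π γ s N b k k h0)]
  have hind : ∀ τ : Traj S A N, ∀ i j : ℕ, cM π γ s N a i τ * cM π γ s N a' j τ = 0 := by
    intro τ i j
    simp only [cM]
    by_cases h : ac τ 0 = a
    · have h' : ac τ 0 ≠ a' := fun h2 => hne (h.symm.trans h2)
      simp [h']
    · simp [h]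
  rw [cv_expand, cv_expand, mean, mean]
  have h1 : expct π P s N (fun τ => mcEst π r γ V s N a τ * mcEst π r γ V s N a' τ) = 0 := by
    refine Finset.sum_eq_zero fun τ _ => ?_
    rw [mc_eq, mc_eq]
    simp only [Finset.sum_mul_sum]
    rw [Finset.sum_eq_zero, mul_zero]
    intro i _
    refine Finset.sum_eq_zero fun j _ => ?_
    rw [mul_mul_mul_comm, hind, zero_mul]
  have h2 : 0 ≤ expct π P s N
      (fun τ => dhcaEst π P r γ V s N a τ * dhcaEst π P r γ V s N a' τ) := by
    rw [dh_eq π P r γ V s N hN, dh_eq π P r γ V s N hN]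
    simp only [Finset.sum_mul_sum]
    rw [expct_sum]
    refine Finset.sum_nonneg fun i hi => ?_
    rw [expct_sum]
    refine Finset.sum_nonneg fun j hj => ?_
    have hi' := Finset.mem_range.mp hi
    have hj' := Finset.mem_range.mp hj
    rcases lt_trichotomy i j with h | h | h
    · refine le_of_eq ?_
      rw [← mart j N hj' (fun τ => cD π P γ s N a i τ * td r γ V s τ i * cD π P γ s N a' j τ)]
      · congr 1
        funext τ
        ring
      · intro τ τ' hh
        simp only
        rw [cD_congr π P γ s N a i j (by omega) h.le τ τ' hh,
          cD_congr π P γ s N a' j j (by omega) le_rfl τ τ' hh, td_congr r γ V s hh h]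
    · subst h
      refine Finset.sum_nonneg fun τ _ => mul_nonneg (trajP_nonneg π P s N hπpos hPnn τ) ?_
      beta_reduce
      rw [mul_mul_mul_comm]
      refine mul_nonneg ?_ (mul_self_nonneg _)
      by_cases h0 : i = 0
      · simp only [cD, h0, if_true]
        rw [hind]
      · simp only [cD, h0, if_false]
        have q : ∀ b, 0 ≤ γ ^ i * (pkA π P s N i b (st s τ i) / π s b) := fun b =>
          mul_nonneg (pow_nonneg hγ0 _)
            (div_nonneg (pkA_nonneg π P s N i hπpos hPnn _ _) (hπpos _ _).le)
        exact mul_nonneg (q a) (q a')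
    · refine le_of_eq ?_
      rw [← mart i N hi' (fun τ => cD π P γ s N a' j τ * td r γ V s τ j * cD π P γ s N a i τ)]
      · congr 1
        funext τ
        ring
      · intro τ τ' hh
        simp only
        rw [cD_congr π P γ s N a' j i (by omega) h.le τ τ' hh,
          cD_congr π P γ s N a i i (by omega) le_rfl τ τ' hh, td_congr r γ V s hh h]
  rw [h1]
  linarith

end HCA
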